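/- Let n ≥ 2 and let ν be an even, finite Borel measure on the unit sphere S^{n−1} of ℝⁿ with ν(S^{n−1}) > 0 that satisfies the strict subspace concentration inequality. Fix α ≠ 0 and let F be a positive, continuous, α-homogeneous functional on convex bodies of ℝⁿ satisfying properties (A), (B) and (C), with associated measures σ_K. Then there exists an origin-symmetric convex body K ∈ 𝒦ⁿ_e such that ν equals the variational measure V_{F,K}, i.e. ν(E) = (1/|α|) ∫_E h_K(u) dσ_K(u) for every Borel set E ⊆ S^{n−1}; in particular ν(S^{n−1}) = F(K). -/

import Mathlib

open MeasureTheory Filter Topology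
open scoped InnerProductSpace ENNReal Pointwise

noncomputable section

/-- The unit sphere `S^{n-1}` of `ℝⁿ`. -/
def unitSphere (n : ℕ) : Set (EuclideanSpace ℝ (Fin n)) := Metric.sphere 0 1

/-- A convex body: compact, convex, with nonempty interior. -/
def IsConvexBody {n : ℕ} (K : Set (EuclideanSpace ℝ (Fin n))) : Prop :=
  IsCompact K ∧ Convex ℝ K ∧ (interior K).Nonempty

/-- The support function `h_K(u) = sup_{y ∈ K} ⟨y, u⟩`. -/
def suppFn {n : ℕ} (K : Set (EuclideanSpace ℝ (Fin n))) (u : EuclideanSpace ℝ (Fin n)) : ℝ :=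
  sSup ((fun y => ⟪y, u⟫_ℝ) '' K)

/-- The Wulff shape `[f] = {x : ⟨x,u⟫ ≤ f u for all u ∈ S^{n-1}}`. -/
def wulff {n : ℕ} (f : EuclideanSpace ℝ (Fin n) → ℝ) : Set (EuclideanSpace ℝ (Fin n)) :=
  {x | ∀ u ∈ unitSphere n, ⟪x, u⟫_ℝ ≤ f u}

section SupportFunction

variable {n : ℕ} {K L : Set (EuclideanSpace ℝ (Fin n))} {u v x y : EuclideanSpace ℝ (Fin n)}

lemma bddAbove_inner_image (hK : IsCompact K) (u : EuclideanSpace ℝ (Fin n)) :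
    BddAbove ((fun y => ⟪y, u⟫_ℝ) '' K) :=
  (hK.image (by fun_prop)).bddAbove

lemma inner_le_suppFn (hK : IsCompact K) (hy : y ∈ K) (u : EuclideanSpace ℝ (Fin n)) :
    ⟪y, u⟫_ℝ ≤ suppFn K u :=
  le_csSup (bddAbove_inner_image hK u) ⟨y, hy, rfl⟩

lemma suppFn_le (hne : K.Nonempty) {c : ℝ} (h : ∀ y ∈ K, ⟪y, u⟫_ℝ ≤ c) : suppFn K u ≤ c :=
  csSup_le (hne.image _) (by rintro _ ⟨y, hy, rfl⟩; exact h y hy)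

lemma exists_inner_eq_suppFn (hK : IsCompact K) (hne : K.Nonempty)
    (u : EuclideanSpace ℝ (Fin n)) : ∃ y ∈ K, ⟪y, u⟫_ℝ = suppFn K u :=
  (hK.image (by fun_prop)).sSup_mem (hne.image fun y => ⟪y, u⟫_ℝ)

lemma suppFn_smul_right (hK : IsCompact K) (hne : K.Nonempty) {c : ℝ} (hc : 0 ≤ c)
    (u : EuclideanSpace ℝ (Fin n)) : suppFn K (c • u) = c * suppFn K u := by
  apply le_antisymm
  · refine suppFn_le hne fun y hy => ?_
    rw [real_inner_smul_right]
    exact mul_le_mul_of_nonneg_left (inner_le_suppFn hK hy u) hc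
  · obtain ⟨y, hy, h⟩ := exists_inner_eq_suppFn hK hne u
    rw [← h, ← real_inner_smul_right]
    exact inner_le_suppFn hK hy _

lemma suppFn_smul_set (hK : IsCompact K) (hne : K.Nonempty) {c : ℝ} (hc : 0 ≤ c)
    (u : EuclideanSpace ℝ (Fin n)) : suppFn (c • K) u = c * suppFn K u := by
  rw [← suppFn_smul_right hK hne hc]
  unfold suppFn
  congr 1
  ext z
  simp [Set.mem_smul_set, real_inner_smul_left, real_inner_smul_right]

lemma suppFn_neg_right (hsymm : K = -K) (u : EuclideanSpace ℝ (Fin n)) :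
    suppFn K (-u) = suppFn K u := by
  unfold suppFn
  congr 1
  ext z
  constructor
  · rintro ⟨y, hy, rfl⟩
    exact ⟨-y, by rw [hsymm]; simpa using hy, by simp⟩
  · rintro ⟨y, hy, rfl⟩
    exact ⟨-y, by rw [hsymm]; simpa using hy, by simp⟩

lemma suppFn_add_le (hK : IsCompact K) (hne : K.Nonempty) (u v : EuclideanSpace ℝ (Fin n)) :
    suppFn K (u + v) ≤ suppFn K u + suppFn K v :=
  suppFn_le hne fun y hy => by
    rw [inner_add_right]
    exact add_le_add (inner_le_suppFn hK hy u) (inner_le_suppFn hK hy v)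

lemma suppFn_le_of_subset_closedBall (hne : K.Nonempty) {R : ℝ}
    (hR : K ⊆ Metric.closedBall 0 R) (u : EuclideanSpace ℝ (Fin n)) :
    suppFn K u ≤ R * ‖u‖ :=
  suppFn_le hne fun y hy => (real_inner_le_norm y u).trans
    (mul_le_mul_of_nonneg_right (by simpa using hR hy) (norm_nonneg u))

lemma continuous_suppFn (hK : IsCompact K) (hne : K.Nonempty) : Continuous (suppFn K) := by
  obtain ⟨R, hR⟩ := hK.isBounded.subset_closedBall (0 : EuclideanSpace ℝ (Fin n))
  refine (LipschitzWith.of_le_add_mul R.toNNReal fun u v => ?_).continuous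
  have h := suppFn_add_le hK hne v (u - v)
  rw [add_sub_cancel] at h
  refine h.trans (add_le_add_right ?_ _)
  rw [dist_eq_norm]
  exact (suppFn_le_of_subset_closedBall hne hR _).trans
    (mul_le_mul_of_nonneg_right (Real.le_coe_toNNReal R) (norm_nonneg _))

lemma subset_closedBall_of_suppFn_le (hK : IsCompact K) {R : ℝ} (hR : 0 ≤ R)
    (h : ∀ u ∈ unitSphere n, suppFn K u ≤ R) : K ⊆ Metric.closedBall 0 R := by
  intro x hx
  rw [mem_closedBall_zero_iff]
  rcases eq_or_ne x 0 with rfl | hx0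
  · simpa using hR
  have hu : (‖x‖⁻¹ • x) ∈ unitSphere n := by
    simp [unitSphere, norm_smul, hx0]
  have := (inner_le_suppFn hK hx _).trans (h _ hu)
  rwa [real_inner_smul_right, real_inner_self_eq_norm_sq, sq, inv_mul_cancel_left₀
    (norm_ne_zero_iff.2 hx0)] at this

lemma le_suppFn_of_closedBall_subset (hK : IsCompact K) {c : ℝ} (hc : 0 ≤ c)
    (h : Metric.closedBall 0 c ⊆ K) (hu : u ∈ unitSphere n) : c ≤ suppFn K u := by
  have hu1 : ‖u‖ = 1 := by simpa [unitSphere] using hu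
  have := inner_le_suppFn hK (h (show c • u ∈ _ by simp [norm_smul, hu1, abs_of_nonneg hc])) u
  simpa [real_inner_smul_left, hu1] using this

lemma closedBall_subset_of_le_suppFn (hK : IsCompact K) (hconv : Convex ℝ K) (hne : K.Nonempty)
    {c : ℝ} (h : ∀ u ∈ unitSphere n, c ≤ suppFn K u) : Metric.closedBall 0 c ⊆ K := by
  intro x hx
  by_contra hxK
  obtain ⟨f, s, hs, hsx⟩ := geometric_hahn_banach_closed_point hconv hK.isClosed hxK
  set w := (InnerProductSpace.toDual ℝ (EuclideanSpace ℝ (Fin n))).symm f with hw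
  have hf : ∀ y, f y = ⟪y, w⟫_ℝ := fun y => by
    rw [real_inner_comm, hw, InnerProductSpace.toDual_symm_apply]
  have hlt : suppFn K w < ⟪x, w⟫_ℝ := by
    rw [← hf]
    exact (suppFn_le hne fun y hy => by rw [← hf]; exact (hs y hy).le).trans_lt hsx
  rcases eq_or_ne w 0 with h0 | h0
  · rw [h0] at hlt
    obtain ⟨y, hy⟩ := hne
    have := inner_le_suppFn hK hy (0 : EuclideanSpace ℝ (Fin n))
    simp only [inner_zero_right] at this hlt
    exact absurd hlt (not_lt.2 this)
  · have hw1 : (‖w‖⁻¹ • w) ∈ unitSphere n := by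
      simp [unitSphere, norm_smul, h0]
    have h1 := h _ hw1
    rw [suppFn_smul_right hK hne (by positivity), inv_mul_eq_div,
      le_div_iff₀ (norm_pos_iff.2 h0)] at h1
    have h2 : ⟪x, w⟫_ℝ ≤ c * ‖w‖ := (real_inner_le_norm x w).trans
      (mul_le_mul_of_nonneg_right (by simpa using hx) (norm_nonneg w))
    linarith

lemma suppFn_le_add_hausdorffDist (hK : IsCompact K) (hL : IsCompact L) (hKne : K.Nonempty)
    (hLne : L.Nonempty) (hu : u ∈ unitSphere n) :
    suppFn K u ≤ suppFn L u + Metric.hausdorffDist K L := by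
  have hu1 : ‖u‖ = 1 := by simpa [unitSphere] using hu
  refine suppFn_le hKne fun y hy => ?_
  refine le_of_forall_pos_le_add fun ε hε => ?_
  obtain ⟨z, hz, hyz⟩ := Metric.exists_dist_lt_of_hausdorffDist_lt hy
    (lt_add_of_pos_right _ hε) (Metric.hausdorffEDist_ne_top_of_nonempty_of_bounded hKne hLne
      hK.isBounded hL.isBounded)
  have h1 := inner_le_suppFn hL hz u
  have h2 : ⟪y - z, u⟫_ℝ ≤ dist y z := by
    simpa [dist_eq_norm, hu1] using real_inner_le_norm (y - z) u
  rw [inner_sub_left] at h2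
  linarith

lemma zero_mem_interior_of_symmetric (hK : IsConvexBody K) (hsymm : K = -K) :
    (0 : EuclideanSpace ℝ (Fin n)) ∈ interior K := by
  obtain ⟨x, hx⟩ := hK.2.2
  have hx' : -x ∈ interior K := by
    have h : interior (-K) = -interior K :=
      ((Homeomorph.neg (EuclideanSpace ℝ (Fin n))).preimage_interior K).symm
    rw [hsymm, h]
    simpa using hx
  simpa using hK.2.1.interior hx hx' (a := 1 / 2) (b := 1 / 2) (by norm_num) (by norm_num)
    (by norm_num)

lemma IsConvexBody.nonempty (hK : IsConvexBody K) : K.Nonempty :=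
  hK.2.2.mono interior_subset

lemma suppFn_pos (hK : IsConvexBody K) (hsymm : K = -K) (hu : u ∈ unitSphere n) :
    0 < suppFn K u := by
  obtain ⟨c, hc, hcK⟩ := Metric.nhds_basis_closedBall.mem_iff.1
    (mem_interior_iff_mem_nhds.1 (zero_mem_interior_of_symmetric hK hsymm))
  exact hc.trans_le (le_suppFn_of_closedBall_subset hK.1 hc.le hcK hu)

lemma isConvexBody_smul (hK : IsConvexBody K) {t : ℝ} (ht : 0 < t) : IsConvexBody (t • K) :=
  ⟨hK.1.smul t, hK.2.1.smul t, by
    rw [interior_smul₀ ht.ne']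
    exact hK.2.2.smul_set⟩

lemma smul_eq_neg_smul (hsymm : K = -K) (t : ℝ) : t • K = -(t • K) := by
  conv_lhs => rw [hsymm, Set.smul_set_neg]

end SupportFunction

section Wulff

variable {n : ℕ} {f : EuclideanSpace ℝ (Fin n) → ℝ}

lemma isConvexBody_wulff (hn : 0 < n) (hf : Continuous f) (hpos : ∀ u ∈ unitSphere n, 0 < f u) :
    IsConvexBody (wulff f) := by
  have : Nonempty (Fin n) := ⟨⟨0, hn⟩⟩
  have hS : IsCompact (unitSphere n) := isCompact_sphere _ _
  have hne : (unitSphere n).Nonempty := NormedSpace.sphere_nonempty.2 zero_le_one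
  obtain ⟨a, ha, hamin⟩ := hS.exists_isMinOn hne hf.continuousOn
  obtain ⟨b, hb, hbmax⟩ := hS.exists_isMaxOn hne hf.continuousOn
  have hwulff : wulff f = ⋂ u ∈ unitSphere n, {x | ⟪x, u⟫_ℝ ≤ f u} := by
    ext x
    simp [wulff]
  have hball : Metric.ball 0 (f a) ⊆ wulff f := by
    intro x hx u hu
    have hu1 : ‖u‖ = 1 := by simpa [unitSphere] using hu
    have h1 : ⟪x, u⟫_ℝ ≤ ‖x‖ := by simpa [hu1] using real_inner_le_norm x u
    have h2 : ‖x‖ < f a := by simpa using hx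
    exact h1.trans (h2.le.trans (hamin hu))
  refine ⟨?_, ?_, ?_⟩
  · refine (isCompact_closedBall (0 : EuclideanSpace ℝ (Fin n)) (f b)).of_isClosed_subset ?_ ?_
    · rw [hwulff]
      exact isClosed_biInter fun u _ => isClosed_le (by fun_prop) continuous_const
    · intro x hx
      rw [mem_closedBall_zero_iff]
      rcases eq_or_ne x 0 with rfl | hx0
      · simpa using (hpos b hb).le
      have hu : (‖x‖⁻¹ • x) ∈ unitSphere n := by
        simp [unitSphere, norm_smul, hx0]
      have := (hx _ hu).trans (hbmax hu)
      rwa [real_inner_smul_right, real_inner_self_eq_norm_sq, sq, inv_mul_cancel_left₀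
        (norm_ne_zero_iff.2 hx0)] at this
  · rw [hwulff]
    refine convex_iInter₂ fun u _ => ?_
    have := convex_halfSpace_le (𝕜 := ℝ) (f := fun x => ⟪x, u⟫_ℝ)
      (IsLinearMap.mk (fun x y => inner_add_left x y u)
        (fun c x => real_inner_smul_left x u c)) (f u)
    exact this
  · exact ⟨0, mem_interior_iff_mem_nhds.2
      (Filter.mem_of_superset (Metric.ball_mem_nhds _ (hpos a ha)) hball)⟩

lemma wulff_eq_neg (hf : ∀ u, f (-u) = f u) : wulff f = -wulff f := by
  ext x
  simp only [wulff, Set.mem_neg, Set.mem_ofPred_eq]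
  constructor
  · intro h u hu
    have := h (-u) (by simpa [unitSphere] using hu)
    simpa [hf] using this
  · intro h u hu
    have := h (-u) (by simpa [unitSphere] using hu)
    simpa [hf] using this

lemma suppFn_wulff_le (hne : (wulff f).Nonempty) {u : EuclideanSpace ℝ (Fin n)}
    (hu : u ∈ unitSphere n) : suppFn (wulff f) u ≤ f u :=
  suppFn_le hne fun _ hy => hy u hu

end Wulff

section Frame

variable {n : ℕ} {K : Set (EuclideanSpace ℝ (Fin n))}

/-- Vectors orthogonal to `k < n` given ones, on which the support function is maximal. -/
lemma exists_isMaxOn_suppFn_orthogonal (hK : IsCompact K) (hne : K.Nonempty) {k : ℕ} (hk : k < n)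
    (e : ℕ → EuclideanSpace ℝ (Fin n)) :
    ∃ w : EuclideanSpace ℝ (Fin n), ‖w‖ = 1 ∧ (∀ j < k, ⟪e j, w⟫_ℝ = 0) ∧
      ∀ v, (∀ j < k, ⟪e j, v⟫_ℝ = 0) → suppFn K v ≤ suppFn K w * ‖v‖ := by
  set V : Submodule ℝ (EuclideanSpace ℝ (Fin n)) :=
    Submodule.span ℝ (e '' (Finset.range k : Set ℕ)) with hV
  have hmem : ∀ v, v ∈ Vᗮ ↔ ∀ j < k, ⟪e j, v⟫_ℝ = 0 := by
    intro v
    rw [Submodule.mem_orthogonal]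
    constructor
    · exact fun h j hj => h _ (Submodule.subset_span ⟨j, by simpa using hj, rfl⟩)
    · intro h u hu
      induction hu using Submodule.span_induction with
      | mem x hx =>
        obtain ⟨j, hj, rfl⟩ := hx
        exact h j (by simpa using hj)
      | zero => simp
      | add x y _ _ hx hy => rw [inner_add_left, hx, hy, add_zero]
      | smul a x _ hx => rw [real_inner_smul_left, hx, mul_zero]
  have hfin : Module.finrank ℝ V < n := by
    have h := finrank_span_finset_le_card (R := ℝ) ((Finset.range k).image e)
    rw [Finset.coe_image] at h
    exact (h.trans (Finset.card_image_le.trans (Finset.card_range k).le)).trans_lt hk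
  have hVne : Vᗮ ≠ ⊥ := by
    intro h
    have h1 := V.finrank_add_finrank_orthogonal
    rw [h, finrank_bot, finrank_euclideanSpace_fin] at h1
    omega
  obtain ⟨w₀, hw₀, hw₀0⟩ := Submodule.exists_mem_ne_zero_of_ne_bot hVne
  have hS : IsCompact (unitSphere n ∩ (Vᗮ : Set (EuclideanSpace ℝ (Fin n)))) :=
    (isCompact_sphere _ _).inter_right (Submodule.isClosed_orthogonal V)
  have hunit : ∀ v ∈ Vᗮ, v ≠ 0 →
      ‖v‖⁻¹ • v ∈ unitSphere n ∩ (Vᗮ : Set (EuclideanSpace ℝ (Fin n))) := fun v hv hv0 =>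
    ⟨by simp [unitSphere, norm_smul, hv0], Submodule.smul_mem _ _ hv⟩
  obtain ⟨w, hw, hmax⟩ := hS.exists_isMaxOn ⟨_, hunit w₀ hw₀ hw₀0⟩
    (continuous_suppFn hK hne).continuousOn
  refine ⟨w, by simpa [unitSphere] using hw.1, (hmem w).1 hw.2, fun v hv => ?_⟩
  rcases eq_or_ne v 0 with rfl | hv0
  · simpa using suppFn_smul_right hK hne le_rfl (0 : EuclideanSpace ℝ (Fin n)) |>.le
  · have h := hmax (hunit v ((hmem v).2 hv) hv0)
    simp only [Set.mem_ofPred_eq] at h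
    rw [suppFn_smul_right hK hne (by positivity), inv_mul_eq_div,
      div_le_iff₀ (norm_pos_iff.2 hv0)] at h
    exact h

lemma exists_greedy_sequence (hK : IsCompact K) (hne : K.Nonempty) {k : ℕ} (hk : k ≤ n) :
    ∃ e : ℕ → EuclideanSpace ℝ (Fin n), ∀ i < k, ‖e i‖ = 1 ∧ (∀ j < i, ⟪e j, e i⟫_ℝ = 0) ∧
      ∀ v, (∀ j < i, ⟪e j, v⟫_ℝ = 0) → suppFn K v ≤ suppFn K (e i) * ‖v‖ := by
  induction k with
  | zero => exact ⟨0, by simp⟩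
  | succ k ih =>
    obtain ⟨e, he⟩ := ih (by omega)
    obtain ⟨w, hw1, hw2, hw3⟩ := exists_isMaxOn_suppFn_orthogonal hK hne (k := k) (by omega) e
    refine ⟨Function.update e k w, fun i hi => ?_⟩
    have hlt : ∀ j < i, Function.update e k w j = e j := fun j hj =>
      Function.update_of_ne (by omega) _ _
    rcases Nat.lt_succ_iff_lt_or_eq.1 hi with h | rfl
    · rw [Function.update_of_ne (show i ≠ k by omega)]
      refine ⟨(he i h).1, fun j hj => ?_, fun v hv => (he i h).2.2 v fun j hj => ?_⟩
      · rw [hlt j hj]; exact (he i h).2.1 j hj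
      · rw [← hlt j hj]; exact hv j hj
    · rw [Function.update_self]
      refine ⟨hw1, fun j hj => ?_, fun v hv => hw3 v fun j hj => ?_⟩
      · rw [hlt j hj]; exact hw2 j hj
      · rw [← hlt j hj]; exact hv j hj

/-- An orthonormal basis `e` is a greedy frame of `K` if each `e i` maximizes the support function
of `K` among the unit vectors orthogonal to all the `e j` with `j < i`. -/
def IsGreedyFrame (K : Set (EuclideanSpace ℝ (Fin n)))
    (e : OrthonormalBasis (Fin n) ℝ (EuclideanSpace ℝ (Fin n))) : Prop :=
  ∀ i v, (∀ j < i, ⟪e j, v⟫_ℝ = 0) → suppFn K v ≤ suppFn K (e i) * ‖v‖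

lemma exists_isGreedyFrame (hn : 0 < n) (hK : IsCompact K) (hne : K.Nonempty) :
    ∃ e, IsGreedyFrame K e := by
  have : Nonempty (Fin n) := ⟨⟨0, hn⟩⟩
  obtain ⟨e, he⟩ := exists_greedy_sequence hK hne le_rfl
  have ho : Orthonormal ℝ (fun i : Fin n => e i) := by
    refine ⟨fun i => (he i i.2).1, fun i j hij => ?_⟩
    rcases lt_or_gt_of_ne hij with h | h
    · exact (he j j.2).2.1 i h
    · rw [real_inner_comm]
      exact (he i i.2).2.1 j h
  let b := basisOfOrthonormalOfCardEqFinrank ho (by simp)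
  have hb : ⇑b = fun i : Fin n => e i := coe_basisOfOrthonormalOfCardEqFinrank _ _
  refine ⟨b.toOrthonormalBasis (by rwa [hb]), fun i v hv => ?_⟩
  simp only [Module.Basis.coe_toOrthonormalBasis, hb] at hv ⊢
  exact (he i i.2).2.2 v fun j hj => hv ⟨j, hj.trans i.2⟩ hj

variable {e : OrthonormalBasis (Fin n) ℝ (EuclideanSpace ℝ (Fin n))}

lemma abs_inner_le_suppFn (hK : IsCompact K) (hsymm : K = -K) {x : EuclideanSpace ℝ (Fin n)}
    (hx : x ∈ K) (u : EuclideanSpace ℝ (Fin n)) : |⟪x, u⟫_ℝ| ≤ suppFn K u := by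
  refine abs_le.2 ⟨?_, inner_le_suppFn hK hx u⟩
  have h : -x ∈ K := by
    rw [hsymm]
    simpa using hx
  have := inner_le_suppFn hK h u
  rw [inner_neg_left] at this
  linarith

namespace IsGreedyFrame

lemma antitone (he : IsGreedyFrame K e) : Antitone fun i => suppFn K (e i) := by
  intro i j hij
  have h := he i (e j) fun k hk => e.orthonormal.2 (hk.trans_le hij).ne
  simpa using h

lemma suppFn_le (he : IsGreedyFrame K e) (hn : 0 < n) (v : EuclideanSpace ℝ (Fin n)) :
    suppFn K v ≤ suppFn K (e ⟨0, hn⟩) * ‖v‖ :=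
  he ⟨0, hn⟩ v fun _ hj => absurd hj (Nat.not_lt_zero _)

/-- A maximizer of `⟪·, e i⟫` on `K` is orthogonal to the later vectors of the frame. -/
lemma inner_eq_zero_of_inner_eq_suppFn (he : IsGreedyFrame K e) (hK : IsCompact K)
    {i j : Fin n} (hij : i < j) {x : EuclideanSpace ℝ (Fin n)} (hx : x ∈ K)
    (hxi : ⟪x, e i⟫_ℝ = suppFn K (e i)) (hpos : 0 < suppFn K (e i)) : ⟪x, e j⟫_ℝ = 0 := by
  set r := suppFn K (e i)
  set s := ⟪x, e j⟫_ℝ with hs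
  set v := r • e i + s • e j
  have hij0 : ⟪e i, e j⟫_ℝ = 0 := e.orthonormal.2 hij.ne
  have h1 : ⟪x, v⟫_ℝ = r ^ 2 + s ^ 2 := by
    simp only [v, inner_add_right, real_inner_smul_right, hxi, ← hs]
    ring
  have h2 : ‖v‖ ^ 2 = r ^ 2 + s ^ 2 := by
    simp only [v, norm_add_sq_real, norm_smul, real_inner_smul_left, real_inner_smul_right, hij0,
      e.norm_eq_one, Real.norm_eq_abs, mul_one, sq_abs]
    ring
  have h3 : ⟪x, v⟫_ℝ ≤ r * ‖v‖ := (inner_le_suppFn hK hx v).trans <| he i v fun k hk => by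
    simp [v, inner_add_right, real_inner_smul_right, e.orthonormal.2 hk.ne,
      e.orthonormal.2 (hk.trans hij).ne]
  rw [h1, ← h2, sq] at h3
  have hv0 : 0 < ‖v‖ := by
    refine lt_of_le_of_ne (norm_nonneg v) fun h => ?_
    rw [← h] at h2
    nlinarith [sq_nonneg s]
  have h4 : ‖v‖ ≤ r := le_of_mul_le_mul_right h3 hv0
  have h5 : s ^ 2 ≤ 0 := by nlinarith
  exact pow_eq_zero_iff two_ne_zero |>.1 (le_antisymm h5 (sq_nonneg s))

lemma suppFn_mul_abs_inner_le (he : IsGreedyFrame K e) (hK : IsCompact K) (hsymm : K = -K)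
    (hpos : ∀ i, 0 < suppFn K (e i)) (hne : K.Nonempty) (u : EuclideanSpace ℝ (Fin n))
    (i : Fin n) : suppFn K (e i) * |⟪e i, u⟫_ℝ| ≤ 2 ^ (i : ℕ) * suppFn K u := by
  induction hi : (i : ℕ) using Nat.strong_induction_on generalizing i with
  | _ k ih =>
    subst hi
    obtain ⟨x, hx, hxi⟩ := exists_inner_eq_suppFn hK hne (e i)
    have hsum : ⟪x, u⟫_ℝ = suppFn K (e i) * ⟪e i, u⟫_ℝ +
        ∑ j ∈ Finset.Iio i, ⟪x, e j⟫_ℝ * ⟪e j, u⟫_ℝ := by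
      rw [← e.sum_inner_mul_inner x u, ← hxi, ← Finset.sum_insert (by simp)
        (f := fun j => ⟪x, e j⟫_ℝ * ⟪e j, u⟫_ℝ)]
      refine (Finset.sum_subset (Finset.subset_univ _) fun j _ hj => ?_).symm
      have hij : i < j := by
        simp only [Finset.mem_insert, Finset.mem_Iio, not_or, not_lt] at hj
        exact lt_of_le_of_ne hj.2 (Ne.symm hj.1)
      rw [he.inner_eq_zero_of_inner_eq_suppFn hK hij hx hxi (hpos i), zero_mul]
    have hbound : |∑ j ∈ Finset.Iio i, ⟪x, e j⟫_ℝ * ⟪e j, u⟫_ℝ| ≤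
        ∑ j ∈ Finset.Iio i, 2 ^ (j : ℕ) * suppFn K u := by
      refine (Finset.abs_sum_le_sum_abs _ _).trans (Finset.sum_le_sum fun j hj => ?_)
      rw [abs_mul]
      exact (mul_le_mul_of_nonneg_right (abs_inner_le_suppFn hK hsymm hx _) (abs_nonneg _)).trans
        (ih j (by simpa using hj) j rfl)
    have hgeom : ∑ j ∈ Finset.Iio i, (2 : ℝ) ^ (j : ℕ) = 2 ^ (i : ℕ) - 1 := by
      have h : ∑ j ∈ Finset.Iio i, (2 : ℝ) ^ (j : ℕ) =
          ∑ j ∈ (Finset.Iio i).map Fin.valEmbedding, (2 : ℝ) ^ j := by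
        rw [Finset.sum_map]
        rfl
      rw [h, Fin.map_valEmbedding_Iio, Nat.Iio_eq_range, geom_sum_eq (by norm_num)]
      norm_num
    rw [← Finset.sum_mul, hgeom] at hbound
    have h1 : suppFn K (e i) * |⟪e i, u⟫_ℝ| = |suppFn K (e i) * ⟪e i, u⟫_ℝ| := by
      rw [abs_mul, abs_of_pos (hpos i)]
    rw [h1, eq_sub_of_add_eq hsum.symm]
    refine (abs_sub _ _).trans ?_
    have h2 := abs_inner_le_suppFn hK hsymm hx u
    linarith

end IsGreedyFrame

lemma volume_le_prod_suppFn (hK : IsCompact K) (hsymm : K = -K) (hpos : ∀ i, 0 < suppFn K (e i)) :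
    (volume K).toReal ≤ ∏ i, (2 * suppFn K (e i)) := by
  set B : Set (EuclideanSpace ℝ (Fin n)) := WithLp.ofLp ⁻¹'
    Set.Icc (fun i => -suppFn K (e i)) (fun i => suppFn K (e i))
  have hB : volume B = ENNReal.ofReal (∏ i, (2 * suppFn K (e i))) := by
    rw [(PiLp.volume_preserving_ofLp (Fin n)).measure_preimage measurableSet_Icc.nullMeasurableSet,
      Real.volume_Icc_pi, ENNReal.ofReal_prod_of_nonneg fun i _ => by
        have := hpos i
        positivity]
    refine Finset.prod_congr rfl fun i _ => ?_
    congr 1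
    ring
  have hBm : MeasurableSet B := (PiLp.volume_preserving_ofLp (Fin n)).measurable measurableSet_Icc
  have hsub : K ⊆ e.repr ⁻¹' B := by
    intro x hx
    simp only [B, Set.mem_preimage, Set.mem_Icc, Pi.le_def, ← forall_and, e.repr_apply_apply]
    intro i
    rw [← abs_le, real_inner_comm]
    exact abs_inner_le_suppFn hK hsymm hx (e i)
  have h := measure_mono (μ := volume) hsub
  rw [e.measurePreserving_repr.measure_preimage hBm.nullMeasurableSet, hB] at h
  exact ENNReal.toReal_le_of_le_ofReal
    (Finset.prod_nonneg fun i _ => by have := hpos i; positivity) h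

end Frame

section Concentration

variable {n : ℕ} {ν : Measure (EuclideanSpace ℝ (Fin n))} [IsFiniteMeasure ν]

lemma isCompact_setOf_orthonormal (n : ℕ) :
    IsCompact {e : Fin n → EuclideanSpace ℝ (Fin n) | Orthonormal ℝ e} := by
  refine (isCompact_univ_pi fun _ : Fin n =>
    isCompact_closedBall (0 : EuclideanSpace ℝ (Fin n)) 1).of_isClosed_subset ?_ ?_
  · simp only [orthonormal_iff_ite, Set.ofPred_forall]
    exact isClosed_iInter fun i => isClosed_iInter fun j =>
      isClosed_eq (by fun_prop) continuous_const
  · intro e he i _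
    simpa using (he.1 i).le

/-- The unit vectors which are `δ`-almost orthogonal to the first `k` vectors of a frame. -/
def almostOrthogonal (e : Fin n → EuclideanSpace ℝ (Fin n)) (k : ℕ) (δ : ℝ) :
    Set (EuclideanSpace ℝ (Fin n)) :=
  {u | ∀ i : Fin n, (i : ℕ) < k → |⟪e i, u⟫_ℝ| ≤ δ}

lemma measurableSet_almostOrthogonal (e : Fin n → EuclideanSpace ℝ (Fin n)) (k : ℕ) (δ : ℝ) :
    MeasurableSet (almostOrthogonal e k δ) := by
  simp only [almostOrthogonal, Set.ofPred_forall]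
  exact (isClosed_iInter fun i => isClosed_iInter fun _ =>
      isClosed_le (by fun_prop) continuous_const).measurableSet

lemma measureReal_setOf_inner_eq_zero_lt (hνsupp : ν (unitSphere n)ᶜ = 0)
    (hνscc : ∀ H : Submodule ℝ (EuclideanSpace ℝ (Fin n)),
      0 < Module.finrank ℝ H → Module.finrank ℝ H < n →
      ν ((H : Set (EuclideanSpace ℝ (Fin n))) ∩ unitSphere n)
        < ((Module.finrank ℝ H : ℝ≥0∞) / (n : ℝ≥0∞)) * ν (unitSphere n))
    {e : Fin n → EuclideanSpace ℝ (Fin n)} (he : Orthonormal ℝ e) {k : ℕ} (hk : 0 < k)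
    (hkn : k < n) :
    ν.real (almostOrthogonal e k 0) < ((n : ℝ) - k) / n * ν.real Set.univ := by
  set f : Fin k → EuclideanSpace ℝ (Fin n) := fun i => e (Fin.castLE hkn.le i) with hf
  have hfo : Orthonormal ℝ f := he.comp _ (Fin.castLE_injective hkn.le)
  set H := (Submodule.span ℝ (Set.range f))ᗮ with hH
  have hrank : Module.finrank ℝ H = n - k := by
    have h1 := (Submodule.span ℝ (Set.range f)).finrank_add_finrank_orthogonal
    rw [finrank_span_eq_card hfo.linearIndependent, Fintype.card_fin,
      finrank_euclideanSpace_fin, ← hH] at h1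
    omega
  have hset : almostOrthogonal e k 0 = H := by
    ext u
    simp only [almostOrthogonal, Set.mem_ofPred_eq, SetLike.mem_coe, hH, abs_nonpos_iff]
    rw [Submodule.mem_orthogonal]
    constructor
    · intro h v hv
      induction hv using Submodule.span_induction with
      | mem x hx =>
        obtain ⟨j, rfl⟩ := hx
        exact h _ (by simp)
      | zero => simp
      | add x y _ _ hx hy => rw [inner_add_left, hx, hy, add_zero]
      | smul a x _ hx => rw [real_inner_smul_left, hx, mul_zero]
    · exact fun h i hi => h _ (Submodule.subset_span ⟨⟨i, hi⟩, rfl⟩)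
  have hS : ν.restrict (unitSphere n) = ν :=
    Measure.restrict_eq_self_of_ae_mem (by rwa [ae_iff])
  have h := hνscc H (by omega) (by omega)
  have hm : MeasurableSet (unitSphere n) := Metric.isClosed_sphere.measurableSet
  have hinter : ∀ s, ν (s ∩ unitSphere n) = ν s := fun s => by
    rw [← Measure.restrict_apply' hm, hS]
  have huniv := hinter Set.univ
  rw [Set.univ_inter] at huniv
  rw [hinter, huniv, hrank] at h
  have h2 := (ENNReal.toReal_lt_toReal (measure_ne_top _ _) (ne_top_of_le_ne_top
    (ENNReal.mul_ne_top (ENNReal.div_ne_top (ENNReal.natCast_ne_top _)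
      (by simp; omega)) (measure_ne_top _ _)) le_rfl)).2 h
  rw [ENNReal.toReal_mul, ENNReal.toReal_div, ENNReal.toReal_natCast, ENNReal.toReal_natCast,
    Nat.cast_sub hkn.le] at h2
  rw [hset]
  exact h2

lemma eventually_measureReal_almostOrthogonal_le (hνsupp : ν (unitSphere n)ᶜ = 0)
    (hνscc : ∀ H : Submodule ℝ (EuclideanSpace ℝ (Fin n)),
      0 < Module.finrank ℝ H → Module.finrank ℝ H < n →
      ν ((H : Set (EuclideanSpace ℝ (Fin n))) ∩ unitSphere n)
        < ((Module.finrank ℝ H : ℝ≥0∞) / (n : ℝ≥0∞)) * ν (unitSphere n))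
    {k : ℕ} (hk : 0 < k) (hkn : k < n) :
    ∀ᶠ δ : ℝ in 𝓝[>] 0, ∀ e ∈ {e : Fin n → EuclideanSpace ℝ (Fin n) | Orthonormal ℝ e},
      ν.real (almostOrthogonal e k δ) ≤ ((n : ℝ) - k) / n * ν.real Set.univ - δ := by
  refine (isCompact_setOf_orthonormal n).induction_on
    (p := fun s => ∀ᶠ δ : ℝ in 𝓝[>] 0, ∀ e ∈ s,
      ν.real (almostOrthogonal e k δ) ≤ ((n : ℝ) - k) / n * ν.real Set.univ - δ) (by simp)
    (fun s t hst ht => ht.mono fun δ h e he => h e (hst he)) (fun s t hs ht => ?_) fun e₀ he₀ => ?_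
  · filter_upwards [hs, ht] with δ h1 h2 e he
    exact he.elim (h1 e) (h2 e)
  have hinter : (⋂ r > (0 : ℝ), almostOrthogonal e₀ k r) = almostOrthogonal e₀ k 0 := by
    ext u
    simp only [almostOrthogonal, Set.mem_iInter, Set.mem_ofPred_eq]
    exact ⟨fun h i hi => le_of_forall_gt_imp_ge_of_dense fun r hr => h r hr i hi,
      fun h r hr i hi => (h i hi).trans (le_of_lt hr)⟩
  have ht : Tendsto (fun r => ν.real (almostOrthogonal e₀ k r)) (𝓝[>] 0)
      (𝓝 (ν.real (almostOrthogonal e₀ k 0))) := by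
    have h := tendsto_measure_biInter_gt (μ := ν) (s := almostOrthogonal e₀ k) (a := (0 : ℝ))
      (fun r _ => (measurableSet_almostOrthogonal e₀ k r).nullMeasurableSet)
      (fun i j _ hij u hu l hl => (hu l hl).trans hij) ⟨1, one_pos, measure_ne_top _ _⟩
    rw [hinter] at h
    exact (ENNReal.tendsto_toReal (measure_ne_top _ _)).comp h
  have ht' : Tendsto (fun r => ν.real (almostOrthogonal e₀ k r) + r) (𝓝[>] 0)
      (𝓝 (ν.real (almostOrthogonal e₀ k 0) + 0)) :=
    ht.add (tendsto_id.mono_left nhdsWithin_le_nhds)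
  rw [add_zero] at ht'
  obtain ⟨δ₀, hlt, hδ₀⟩ := ((ht'.eventually_lt_const
    (measureReal_setOf_inner_eq_zero_lt hνsupp hνscc he₀ hk hkn)).and
    self_mem_nhdsWithin).exists
  have hδ₀ : 0 < δ₀ := hδ₀
  refine ⟨Metric.ball e₀ (δ₀ / 2), mem_nhdsWithin_of_mem_nhds
    (Metric.ball_mem_nhds _ (by positivity)), ?_⟩
  filter_upwards [Ioo_mem_nhdsGT (half_pos hδ₀)] with δ hδ e he
  have hle : ν (almostOrthogonal e k δ) ≤ ν (almostOrthogonal e₀ k δ₀) := by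
    refine measure_mono_ae ?_
    have hae : ∀ᵐ u ∂ν, u ∈ unitSphere n := by rwa [ae_iff]
    filter_upwards [hae] with u hu hmem i hi
    have hu1 : ‖u‖ = 1 := by simpa [unitSphere] using hu
    have h1 : |⟪e₀ i - e i, u⟫_ℝ| ≤ ‖e₀ i - e i‖ := by
      simpa [hu1] using abs_real_inner_le_norm (e₀ i - e i) u
    have h2 : ‖e₀ i - e i‖ ≤ δ₀ / 2 := by
      rw [← dist_eq_norm, dist_comm]
      exact (dist_le_pi_dist e e₀ i).trans (le_of_lt he)
    have h3 := hmem i hi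
    rw [inner_sub_left] at h1
    rw [abs_le] at h1 h3 ⊢
    constructor <;> linarith [hδ.2]
  have hle' : ν.real (almostOrthogonal e k δ) ≤ ν.real (almostOrthogonal e₀ k δ₀) :=
    ENNReal.toReal_mono (measure_ne_top _ _) hle
  linarith [hδ.2]

/-- Strict subspace concentration is uniform over neighbourhoods of all subspaces. -/
lemma exists_uniform_concentration (hνsupp : ν (unitSphere n)ᶜ = 0)
    (hνscc : ∀ H : Submodule ℝ (EuclideanSpace ℝ (Fin n)),
      0 < Module.finrank ℝ H → Module.finrank ℝ H < n →
      ν ((H : Set (EuclideanSpace ℝ (Fin n))) ∩ unitSphere n)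
        < ((Module.finrank ℝ H : ℝ≥0∞) / (n : ℝ≥0∞)) * ν (unitSphere n)) :
    ∃ δ : ℝ, 0 < δ ∧ n * δ ^ 2 < 1 ∧ ∀ e : Fin n → EuclideanSpace ℝ (Fin n), Orthonormal ℝ e →
      ∀ k, 0 < k → k < n →
        ν.real (almostOrthogonal e k δ) ≤ ((n : ℝ) - k) / n * ν.real Set.univ - δ := by
  have h1 : ∀ᶠ δ : ℝ in 𝓝[>] 0, ∀ k ∈ Finset.Ioo 0 n,
      ∀ e ∈ {e : Fin n → EuclideanSpace ℝ (Fin n) | Orthonormal ℝ e},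
      ν.real (almostOrthogonal e k δ) ≤ ((n : ℝ) - k) / n * ν.real Set.univ - δ :=
    (Filter.eventually_all_finset _).2 fun k hk => by
      rw [Finset.mem_Ioo] at hk
      exact eventually_measureReal_almostOrthogonal_le hνsupp hνscc hk.1 hk.2
  have h2 : ∀ᶠ δ : ℝ in 𝓝[>] 0, n * δ ^ 2 < 1 := by
    have : Tendsto (fun δ : ℝ => n * δ ^ 2) (𝓝 0) (𝓝 (n * 0 ^ 2)) :=
      Continuous.tendsto (by fun_prop) 0
    exact (this.mono_left nhdsWithin_le_nhds).eventually_lt_const (by simp)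
  obtain ⟨δ, ⟨h1, h2⟩, hδ⟩ := ((h1.and h2).and self_mem_nhdsWithin).exists
  exact ⟨δ, hδ, h2, fun e he k hk hkn => h1 k (Finset.mem_Ioo.2 ⟨hk, hkn⟩) e he⟩

lemma add_sum_sub_mul_eq_sum (ℓ : ℕ → ℝ) (N : ℕ) :
    (N + 1) * ℓ 0 + ∑ j ∈ Finset.range N, (ℓ (j + 1) - ℓ j) * (N - j) =
      ∑ k ∈ Finset.range (N + 1), ℓ k := by
  induction N with
  | zero => simp
  | succ N ih =>
    rw [Finset.sum_range_succ _ (N + 1), ← ih, Finset.sum_range_succ]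
    have h : ∑ j ∈ Finset.range N, (ℓ (j + 1) - ℓ j) * ((N + 1 : ℕ) - j : ℝ) =
        ∑ j ∈ Finset.range N, (ℓ (j + 1) - ℓ j) * (N - j) + (ℓ N - ℓ 0) := by
      rw [← Finset.sum_range_sub, ← Finset.sum_add_distrib]
      refine Finset.sum_congr rfl fun j _ => ?_
      push_cast
      ring
    rw [h]
    push_cast
    ring

lemma exists_le_abs_inner {δ : ℝ} (hδn : n * δ ^ 2 < 1)
    (e : OrthonormalBasis (Fin n) ℝ (EuclideanSpace ℝ (Fin n))) {u : EuclideanSpace ℝ (Fin n)}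
    (hu : u ∈ unitSphere n) : ∃ i, δ < |⟪e i, u⟫_ℝ| := by
  by_contra! h
  have hu1 : ‖u‖ = 1 := by simpa [unitSphere] using hu
  have h1 := e.sum_sq_norm_inner_right u
  have h2 : ∑ i, ‖⟪e i, u⟫_ℝ‖ ^ 2 ≤ ∑ _i : Fin n, δ ^ 2 :=
    Finset.sum_le_sum fun i _ => pow_le_pow_left₀ (norm_nonneg _) (h i) 2
  rw [h1, hu1] at h2
  simp at h2
  linarith

lemma le_integral_of_frame (hνsupp : ν (unitSphere n)ᶜ = 0) (hn : 0 < n) {δ c : ℝ}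
    (hδn : n * δ ^ 2 < 1) (e : OrthonormalBasis (Fin n) ℝ (EuclideanSpace ℝ (Fin n)))
    (hconc : ∀ k, 0 < k → k < n →
      ν.real (almostOrthogonal e k δ) ≤ ((n : ℝ) - k) / n * ν.real Set.univ - δ)
    {ℓ : ℕ → ℝ} (hℓ : ∀ k, k + 1 < n → ℓ (k + 1) ≤ ℓ k)
    {φ : EuclideanSpace ℝ (Fin n) → ℝ} (hφ : Integrable φ ν)
    (hφℓ : ∀ u ∈ unitSphere n, ∀ i : Fin n, δ < |⟪e i, u⟫_ℝ| → ℓ i + c ≤ φ u) :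
    ν.real Set.univ * c + ν.real Set.univ / n * ∑ k ∈ Finset.range n, ℓ k
      + δ * (ℓ 0 - ℓ (n - 1)) ≤ ∫ u, φ u ∂ν := by
  set m := ν.real Set.univ
  obtain ⟨N, rfl⟩ : ∃ N, n = N + 1 := ⟨n - 1, by omega⟩
  set A : ℕ → Set (EuclideanSpace ℝ (Fin (N + 1))) := fun k => almostOrthogonal e k δ
  have hA : ∀ k, MeasurableSet (A k) := fun k => measurableSet_almostOrthogonal _ _ _
  set ψ : EuclideanSpace ℝ (Fin (N + 1)) → ℝ := fun u =>
    (c + ℓ 0) + ∑ j ∈ Finset.range N, (ℓ (j + 1) - ℓ j) * (A (j + 1)).indicator 1 u with hψ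
  have hInt : ∀ j, Integrable (fun u => (ℓ (j + 1) - ℓ j) * (A (j + 1)).indicator 1 u) ν :=
    fun j => ((integrable_const (1 : ℝ)).indicator (hA _)).const_mul _
  have hpt : ∀ u ∈ unitSphere (N + 1), ψ u ≤ φ u := by
    intro u hu
    obtain ⟨i, hi, hmin⟩ := WellFounded.has_min (wellFounded_lt (α := Fin (N + 1)))
      {i | δ < |⟪e i, u⟫_ℝ|} (exists_le_abs_inner hδn e hu)
    refine le_trans ?_ (hφℓ u hu i hi)
    have h1 : ∑ j ∈ Finset.range N, (ℓ (j + 1) - ℓ j) * (A (j + 1)).indicator 1 u ≤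
        ∑ j ∈ Finset.range i, (ℓ (j + 1) - ℓ j) * (A (j + 1)).indicator 1 u := by
      rw [← neg_le_neg_iff, ← Finset.sum_neg_distrib, ← Finset.sum_neg_distrib]
      refine Finset.sum_le_sum_of_subset_of_nonneg
        (Finset.range_subset_range.2 (Nat.lt_succ_iff.1 i.2)) fun j hj _ => ?_
      rw [← neg_mul]
      refine mul_nonneg ?_ (Set.indicator_nonneg (fun _ _ => zero_le_one) _)
      have := hℓ j (by simpa using hj)
      linarith
    have h2 : ∑ j ∈ Finset.range i, (ℓ (j + 1) - ℓ j) * (A (j + 1)).indicator 1 u =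
        ℓ i - ℓ 0 := by
      rw [← Finset.sum_range_sub]
      refine Finset.sum_congr rfl fun j hj => ?_
      have hmem : u ∈ A (j + 1) := fun l hl => not_lt.1 fun h => hmin l h <| by
        rw [Finset.mem_range] at hj
        exact Fin.lt_def.2 (by omega)
      rw [Set.indicator_of_mem hmem, Pi.one_apply, mul_one]
    simp only [hψ]
    linarith
  have hle : ∫ u, ψ u ∂ν ≤ ∫ u, φ u ∂ν := by
    refine integral_mono_ae ((integrable_const _).add (integrable_finsetSum _ fun j _ => hInt j))
      hφ ?_
    have hae : ∀ᵐ u ∂ν, u ∈ unitSphere (N + 1) := by rwa [ae_iff]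
    filter_upwards [hae] with u hu using hpt u hu
  refine le_trans ?_ hle
  have hψint : ∫ u, ψ u ∂ν =
      m * (c + ℓ 0) + ∑ j ∈ Finset.range N, (ℓ (j + 1) - ℓ j) * ν.real (A (j + 1)) := by
    simp only [hψ]
    rw [integral_add (integrable_const _) (integrable_finsetSum _ fun j _ => hInt j),
      integral_const, integral_finsetSum _ fun j _ => hInt j, smul_eq_mul]
    congr 1
    refine Finset.sum_congr rfl fun j _ => ?_
    rw [integral_const_mul, integral_indicator_one (hA _)]
  have hsum : ∑ j ∈ Finset.range N, (ℓ (j + 1) - ℓ j) * ((N - j : ℝ) / (N + 1) * m - δ) ≤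
      ∑ j ∈ Finset.range N, (ℓ (j + 1) - ℓ j) * ν.real (A (j + 1)) := by
    refine Finset.sum_le_sum fun j hj => mul_le_mul_of_nonpos_left ?_ ?_
    · rw [Finset.mem_range] at hj
      have := hconc (j + 1) (by omega) (by omega)
      push_cast at this
      convert! this using 3
      ring
    · have := hℓ j (by simpa using hj)
      linarith
  have hsplit : ∑ j ∈ Finset.range N, (ℓ (j + 1) - ℓ j) * ((N - j : ℝ) / (N + 1) * m - δ) =
      m / (N + 1) * ∑ j ∈ Finset.range N, (ℓ (j + 1) - ℓ j) * (N - j) - δ * (ℓ N - ℓ 0) := by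
    rw [← Finset.sum_range_sub, Finset.mul_sum, Finset.mul_sum, ← Finset.sum_sub_distrib]
    refine Finset.sum_congr rfl fun j _ => ?_
    ring
  have hN : (N : ℝ) + 1 ≠ 0 := by positivity
  have habel := add_sum_sub_mul_eq_sum ℓ N
  rw [hψint, ← habel]
  rw [hsplit] at hsum
  refine le_trans (le_of_eq ?_) (add_le_add_right hsum _)
  push_cast
  field_simp
  ring

end Concentration

section LogFunctional

variable {n : ℕ} {ν : Measure (EuclideanSpace ℝ (Fin n))} [IsFiniteMeasure ν]
  {K L : Set (EuclideanSpace ℝ (Fin n))} {α : ℝ} {F : Set (EuclideanSpace ℝ (Fin n)) → ℝ}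

lemma integrable_of_continuousOn_unitSphere (hνsupp : ν (unitSphere n)ᶜ = 0)
    {f : EuclideanSpace ℝ (Fin n) → ℝ} (hf : ContinuousOn f (unitSphere n)) :
    Integrable f ν := by
  have hS : ν.restrict (unitSphere n) = ν :=
    Measure.restrict_eq_self_of_ae_mem (by rwa [ae_iff])
  rw [← hS]
  exact hf.integrableOn_compact (isCompact_sphere _ _)

lemma integrable_log_suppFn (hνsupp : ν (unitSphere n)ᶜ = 0) (hK : IsConvexBody K)
    (hsymm : K = -K) : Integrable (fun u => Real.log (suppFn K u)) ν :=
  integrable_of_continuousOn_unitSphere hνsupp <|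
    (continuous_suppFn hK.1 hK.nonempty).continuousOn.log fun _ hu => (suppFn_pos hK hsymm hu).ne'

/-- The scale-invariant functional minimized by the solution of the logarithmic Minkowski
problem. -/
def logFunctional (ν : Measure (EuclideanSpace ℝ (Fin n))) (α : ℝ)
    (F : Set (EuclideanSpace ℝ (Fin n)) → ℝ) (K : Set (EuclideanSpace ℝ (Fin n))) : ℝ :=
  ∫ u, Real.log (suppFn K u) ∂ν - ν.real Set.univ / α * Real.log (F K)

lemma logFunctional_smul (hνsupp : ν (unitSphere n)ᶜ = 0) (hα : α ≠ 0)
    (hFpos : ∀ K, IsConvexBody K → 0 < F K)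
    (hFhom : ∀ K, IsConvexBody K → ∀ t : ℝ, 0 < t → F (t • K) = t ^ α * F K)
    (hK : IsConvexBody K) (hsymm : K = -K) {t : ℝ} (ht : 0 < t) :
    logFunctional ν α F (t • K) = logFunctional ν α F K := by
  have h1 : ∫ u, Real.log (suppFn (t • K) u) ∂ν =
      ∫ u, (Real.log t + Real.log (suppFn K u)) ∂ν := by
    have hae : ∀ᵐ u ∂ν, u ∈ unitSphere n := by rwa [ae_iff]
    refine integral_congr_ae ?_
    filter_upwards [hae] with u hu
    rw [suppFn_smul_set hK.1 hK.nonempty ht.le,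
      Real.log_mul ht.ne' (suppFn_pos hK hsymm hu).ne']
  rw [logFunctional, logFunctional, h1, integral_add (integrable_const _)
    (integrable_log_suppFn hνsupp hK hsymm), integral_const, hFhom K hK t ht,
    Real.log_mul (Real.rpow_pos_of_pos ht _).ne' (hFpos K hK).ne', Real.log_rpow ht, smul_eq_mul]
  field_simp
  ring

lemma log_le_sum_log_suppFn (hn : 0 < n) (hFpos : ∀ K, IsConvexBody K → 0 < F K)
    {C : ℝ} (hC0 : 0 < C) (hC : ∀ K, IsConvexBody K →
      (F K) ^ (1 / α) ≤ C * (volume K).toReal ^ (1 / (n : ℝ)))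
    (hK : IsConvexBody K) (hsymm : K = -K)
    {e : OrthonormalBasis (Fin n) ℝ (EuclideanSpace ℝ (Fin n))}
    (hpos : ∀ i, 0 < suppFn K (e i)) :
    1 / α * Real.log (F K) ≤
      Real.log C + Real.log 2 + 1 / n * ∑ i, Real.log (suppFn K (e i)) := by
  have hprod : 0 < ∏ i, (2 * suppFn K (e i)) :=
    Finset.prod_pos fun i _ => mul_pos two_pos (hpos i)
  have h1 : (F K) ^ (1 / α) ≤ C * (∏ i, (2 * suppFn K (e i))) ^ (1 / (n : ℝ)) :=
    (hC K hK).trans (mul_le_mul_of_nonneg_left (Real.rpow_le_rpow ENNReal.toReal_nonneg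
      (volume_le_prod_suppFn hK.1 hsymm hpos) (by positivity)) hC0.le)
  have h2 := Real.log_le_log (Real.rpow_pos_of_pos (hFpos K hK) _) h1
  rw [Real.log_rpow (hFpos K hK), Real.log_mul hC0.ne' (Real.rpow_pos_of_pos hprod _).ne',
    Real.log_rpow hprod, Real.log_prod fun i _ => (mul_pos two_pos (hpos i)).ne'] at h2
  simp_rw [fun i => Real.log_mul two_ne_zero (hpos i).ne'] at h2
  rw [Finset.sum_add_distrib, Finset.sum_const, Finset.card_univ, Fintype.card_fin,
    nsmul_eq_mul, mul_add, ← mul_assoc, one_div_mul_cancel (by positivity : (n : ℝ) ≠ 0),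
    one_mul, ← add_assoc] at h2
  exact h2

lemma exists_coercive_bound (hn : 0 < n) (hνsupp : ν (unitSphere n)ᶜ = 0)
    (hνscc : ∀ H : Submodule ℝ (EuclideanSpace ℝ (Fin n)),
      0 < Module.finrank ℝ H → Module.finrank ℝ H < n →
      ν ((H : Set (EuclideanSpace ℝ (Fin n))) ∩ unitSphere n)
        < ((Module.finrank ℝ H : ℝ≥0∞) / (n : ℝ≥0∞)) * ν (unitSphere n))
    (hFpos : ∀ K, IsConvexBody K → 0 < F K)
    (hB : ∃ C : ℝ, 0 < C ∧ ∀ K, IsConvexBody K →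
      (F K) ^ (1 / α) ≤ C * (volume K).toReal ^ (1 / (n : ℝ))) :
    ∃ A η c : ℝ, 0 < η ∧ 0 < c ∧ ∀ K, IsConvexBody K → K = -K →
      ∃ s R : ℝ, 0 < s ∧ 0 < R ∧ K ⊆ Metric.closedBall 0 R ∧ Metric.closedBall 0 (c * s) ⊆ K ∧
        A + η * (Real.log R - Real.log s) ≤ logFunctional ν α F K := by
  obtain ⟨C, hC0, hC⟩ := hB
  obtain ⟨δ, hδ, hδn, hconc⟩ := exists_uniform_concentration hνsupp hνscc
  set m := ν.real Set.univ with hm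
  refine ⟨m * (Real.log δ - n * Real.log 2) - m * (Real.log C + Real.log 2), δ, δ / 2 ^ n, hδ,
    by positivity, fun K hK hsymm => ?_⟩
  obtain ⟨e, he⟩ := exists_isGreedyFrame hn hK.1 hK.nonempty
  have hpos : ∀ i, 0 < suppFn K (e i) := fun i =>
    suppFn_pos hK hsymm (by simp [unitSphere])
  have hlow : ∀ u ∈ unitSphere n, ∀ i, δ < |⟪e i, u⟫_ℝ| →
      suppFn K (e i) * δ ≤ 2 ^ n * suppFn K u := fun u hu i hi =>
    (mul_le_mul_of_nonneg_left hi.le (hpos i).le).trans <|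
      (he.suppFn_mul_abs_inner_le hK.1 hsymm hpos hK.nonempty u i).trans <|
        mul_le_mul_of_nonneg_right (pow_le_pow_right₀ one_le_two i.2.le)
          (suppFn_pos hK hsymm hu).le
  set last : Fin n := ⟨n - 1, by omega⟩
  refine ⟨suppFn K (e last), suppFn K (e ⟨0, hn⟩), hpos _, hpos _, ?_, ?_, ?_⟩
  · refine subset_closedBall_of_suppFn_le hK.1 (hpos _).le fun u hu => ?_
    have hu1 : ‖u‖ = 1 := by simpa [unitSphere] using hu
    simpa [hu1] using he.suppFn_le hn u
  · refine closedBall_subset_of_le_suppFn hK.1 hK.2.1 hK.nonempty fun u hu => ?_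
    obtain ⟨i, hi⟩ := exists_le_abs_inner hδn e hu
    have hle : suppFn K (e last) ≤ suppFn K (e i) :=
      he.antitone (Fin.le_def.2 (by have := i.2; simp only [last]; omega))
    rw [div_mul_eq_mul_div, div_le_iff₀ (by positivity), mul_comm δ, mul_comm _ (2 ^ n : ℝ)]
    exact (mul_le_mul_of_nonneg_right hle hδ.le).trans (hlow u hu i hi)
  · set ℓ : ℕ → ℝ := fun k => if h : k < n then Real.log (suppFn K (e ⟨k, h⟩)) else 0 with hℓ
    have hℓi : ∀ i : Fin n, ℓ i = Real.log (suppFn K (e i)) := fun i => by simp [hℓ]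
    have hanti : ∀ k, k + 1 < n → ℓ (k + 1) ≤ ℓ k := fun k hk => by
      rw [hℓi ⟨k + 1, hk⟩, hℓi ⟨k, by omega⟩]
      exact Real.log_le_log (hpos _) (he.antitone (Fin.le_def.2 (Nat.le_succ k)))
    have hbound := le_integral_of_frame hνsupp hn hδn e (hconc e e.orthonormal) hanti
      (integrable_log_suppFn hνsupp hK hsymm) (c := Real.log δ - n * Real.log 2)
      fun u hu i hi => by
        have h := Real.log_le_log (mul_pos (hpos i) hδ) (hlow u hu i hi)
        rw [Real.log_mul (hpos i).ne' hδ.ne', Real.log_mul (by positivity)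
          (suppFn_pos hK hsymm hu).ne', Real.log_pow] at h
        rw [hℓi]
        linarith
    rw [← Fin.sum_univ_eq_sum_range, Finset.sum_congr rfl fun i _ => hℓi i, ← hm,
      hℓi ⟨0, hn⟩, hℓi last] at hbound
    have hF := mul_le_mul_of_nonneg_left
      (log_le_sum_log_suppFn hn hFpos hC0 hC hK hsymm hpos) (measureReal_nonneg :
        0 ≤ ν.real Set.univ)
    rw [← hm] at hF
    rw [logFunctional, ← hm]
    have h1 : m / α * Real.log (F K) = m * (1 / α * Real.log (F K)) := by ring
    have h2 : m / n * ∑ i, Real.log (suppFn K (e i)) =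
      m * (1 / n * ∑ i, Real.log (suppFn K (e i))) := by ring
    rw [h1]
    rw [h2] at hbound
    linarith

open TopologicalSpace in
lemma isCompact_symmetric_convex_between (n : ℕ) (ρ R : ℝ) :
    IsCompact {L : NonemptyCompacts (EuclideanSpace ℝ (Fin n)) |
      (L : Set (EuclideanSpace ℝ (Fin n))) ⊆ Metric.closedBall 0 R ∧
      Convex ℝ (L : Set (EuclideanSpace ℝ (Fin n))) ∧
      (L : Set (EuclideanSpace ℝ (Fin n))) = -(L : Set (EuclideanSpace ℝ (Fin n))) ∧
      Metric.closedBall 0 ρ ⊆ (L : Set (EuclideanSpace ℝ (Fin n)))} := by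
  refine (NonemptyCompacts.isCompact_subsets_of_isCompact
    (isCompact_closedBall (0 : EuclideanSpace ℝ (Fin n)) R)).of_isClosed_subset ?_
    fun L hL => hL.1
  refine IsSeqClosed.isClosed fun L M hL hLM => ?_
  have hfin : ∀ A B : NonemptyCompacts (EuclideanSpace ℝ (Fin n)),
      Metric.hausdorffEDist (A : Set (EuclideanSpace ℝ (Fin n))) B ≠ ⊤ := fun A B =>
    Metric.hausdorffEDist_ne_top_of_nonempty_of_bounded A.nonempty B.nonempty
      A.isCompact.isBounded B.isCompact.isBounded
  have hd : Tendsto (fun i => dist (L i) M) atTop (𝓝 0) := tendsto_iff_dist_tendsto_zero.1 hLM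
  have hmem : ∀ {x : ℕ → EuclideanSpace ℝ (Fin n)} {y}, (∀ i, x i ∈ L i) →
      Tendsto x atTop (𝓝 y) → y ∈ (M : Set (EuclideanSpace ℝ (Fin n))) := by
    intro x y hx hxy
    rw [M.isCompact.isClosed.mem_iff_infDist_zero M.nonempty]
    refine le_antisymm ?_ Metric.infDist_nonneg
    have h0 : Tendsto (fun i => dist (L i) M + dist y (x i)) atTop (𝓝 (0 + 0)) :=
      hd.add (by simpa [dist_comm] using tendsto_iff_dist_tendsto_zero.1 hxy)
    rw [add_zero] at h0
    refine ge_of_tendsto' h0 fun i =>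
      (Metric.infDist_le_infDist_add_dist (y := x i)).trans (add_le_add ?_ le_rfl)
    exact Metric.infDist_le_hausdorffDist_of_mem (hx i) (hfin _ _)
  have hexists : ∀ y ∈ (M : Set (EuclideanSpace ℝ (Fin n))), ∃ x : ℕ → EuclideanSpace ℝ (Fin n),
      (∀ i, x i ∈ L i) ∧ Tendsto x atTop (𝓝 y) := by
    intro y hy
    choose x hx hxy using fun i => (L i).isCompact.exists_infDist_eq_dist (L i).nonempty y
    refine ⟨x, hx, tendsto_iff_dist_tendsto_zero.2
      (squeeze_zero (fun _ => dist_nonneg) (fun i => ?_) hd)⟩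
    rw [dist_comm, ← hxy i, dist_comm (L i)]
    exact Metric.infDist_le_hausdorffDist_of_mem hy (hfin _ _)
  have hneg : ∀ y ∈ (M : Set (EuclideanSpace ℝ (Fin n))), -y ∈ (M : Set _) := by
    intro y hy
    obtain ⟨x, hx, hxy⟩ := hexists y hy
    refine hmem (fun i => ?_) hxy.neg
    change -x i ∈ (L i : Set (EuclideanSpace ℝ (Fin n)))
    rw [(hL i).2.2.1]
    simpa using hx i
  refine ⟨fun y hy => ?_, ?_, ?_, fun y hy => hmem (fun i => (hL i).2.2.2 hy) tendsto_const_nhds⟩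
  · obtain ⟨x, hx, hxy⟩ := hexists y hy
    exact Metric.isClosed_closedBall.mem_of_tendsto hxy
      (Eventually.of_forall fun i => (hL i).1 (hx i))
  · intro y hy z hz a b ha hb hab
    obtain ⟨y', hy', hyy'⟩ := hexists y hy
    obtain ⟨z', hz', hzz'⟩ := hexists z hz
    exact hmem (fun i => (hL i).2.1 (hy' i) (hz' i) ha hb hab)
      ((hyy'.const_smul a).add (hzz'.const_smul b))
  · ext y
    rw [Set.mem_neg]
    exact ⟨hneg y, fun h => by simpa using hneg _ h⟩

lemma isConvexBody_of_closedBall_subset (hK : IsCompact K) (hconv : Convex ℝ K) {ρ : ℝ}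
    (hρ : 0 < ρ) (h : Metric.closedBall 0 ρ ⊆ K) : IsConvexBody K :=
  ⟨hK, hconv, 0, mem_interior_iff_mem_nhds.2
    (Filter.mem_of_superset (Metric.closedBall_mem_nhds _ hρ) h)⟩

lemma tendsto_integral_log_suppFn (hνsupp : ν (unitSphere n)ᶜ = 0) {ρ : ℝ} (hρ : 0 < ρ)
    {K : ℕ → Set (EuclideanSpace ℝ (Fin n))} (hK : ∀ i, IsConvexBody (K i))
    (hKsymm : ∀ i, K i = -K i) (hL : IsConvexBody L) (hLsymm : L = -L)
    (hKρ : ∀ i, Metric.closedBall 0 ρ ⊆ K i) (hK1 : ∀ i, K i ⊆ Metric.closedBall 0 1)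
    (hKL : Tendsto (fun i => Metric.hausdorffDist (K i) L) atTop (𝓝 0)) :
    Tendsto (fun i => ∫ u, Real.log (suppFn (K i) u) ∂ν) atTop
      (𝓝 (∫ u, Real.log (suppFn L u) ∂ν)) := by
  have hae : ∀ᵐ u ∂ν, u ∈ unitSphere n := by rwa [ae_iff]
  refine tendsto_integral_of_dominated_convergence (fun _ => -Real.log ρ)
    (fun i => (integrable_log_suppFn hνsupp (hK i) (hKsymm i)).aestronglyMeasurable)
    (integrable_const _) (fun i => ?_) ?_
  · filter_upwards [hae] with u hu
    have hu1 : ‖u‖ = 1 := by simpa [unitSphere] using hu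
    have h1 := le_suppFn_of_closedBall_subset (hK i).1 hρ.le (hKρ i) hu
    have h2 := suppFn_le_of_subset_closedBall (hK i).nonempty (hK1 i) u
    rw [hu1, mul_one] at h2
    have h3 := Real.log_le_log hρ h1
    have h4 := Real.log_nonpos (hρ.le.trans h1) h2
    rw [Real.norm_eq_abs, abs_of_nonpos h4]
    linarith
  · filter_upwards [hae] with u hu
    refine Tendsto.log ?_ (suppFn_pos hL hLsymm hu).ne'
    rw [tendsto_iff_dist_tendsto_zero]
    refine squeeze_zero (fun _ => dist_nonneg) (fun i => ?_) hKL
    have h1 := suppFn_le_add_hausdorffDist (hK i).1 hL.1 (hK i).nonempty hL.nonempty hu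
    have h2 := suppFn_le_add_hausdorffDist hL.1 (hK i).1 hL.nonempty (hK i).nonempty hu
    rw [Metric.hausdorffDist_comm] at h2
    rw [Real.dist_eq, abs_le]
    constructor <;> linarith

open TopologicalSpace in
lemma exists_min_logFunctional_between (hνsupp : ν (unitSphere n)ᶜ = 0)
    (hFpos : ∀ K, IsConvexBody K → 0 < F K)
    (hFcont : ∀ (K : ℕ → Set (EuclideanSpace ℝ (Fin n))) (L),
      (∀ i, IsConvexBody (K i)) → IsConvexBody L →
      Tendsto (fun i => Metric.hausdorffDist (K i) L) atTop (𝓝 0) →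
      Tendsto (fun i => F (K i)) atTop (𝓝 (F L)))
    {ρ : ℝ} (hρ : 0 < ρ) (hρ1 : ρ ≤ 1) :
    ∃ K, IsConvexBody K ∧ K = -K ∧ ∀ L, IsConvexBody L → L = -L →
      Metric.closedBall 0 ρ ⊆ L → L ⊆ Metric.closedBall 0 1 →
      logFunctional ν α F K ≤ logFunctional ν α F L := by
  have hcomp := isCompact_symmetric_convex_between n ρ 1
  set T : Set (NonemptyCompacts (EuclideanSpace ℝ (Fin n))) :=
    {L | (L : Set (EuclideanSpace ℝ (Fin n))) ⊆ Metric.closedBall 0 1 ∧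
      Convex ℝ (L : Set (EuclideanSpace ℝ (Fin n))) ∧
      (L : Set (EuclideanSpace ℝ (Fin n))) = -(L : Set (EuclideanSpace ℝ (Fin n))) ∧
      Metric.closedBall 0 ρ ⊆ (L : Set (EuclideanSpace ℝ (Fin n)))}
  have hbody : ∀ L ∈ T, IsConvexBody (L : Set (EuclideanSpace ℝ (Fin n))) := fun L hL =>
    isConvexBody_of_closedBall_subset L.isCompact hL.2.1 hρ hL.2.2.2
  have hcont : ContinuousOn (fun L : NonemptyCompacts (EuclideanSpace ℝ (Fin n)) =>
      logFunctional ν α F L) T := by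
    rw [continuousOn_iff_continuous_domRestrict]
    refine SeqContinuous.continuous fun K L hKL => ?_
    have hd : Tendsto (fun i => Metric.hausdorffDist ((K i).1 : Set (EuclideanSpace ℝ (Fin n)))
        L.1) atTop (𝓝 0) := tendsto_iff_dist_tendsto_zero.1 hKL
    have hb := fun i => hbody _ (K i).2
    have hbL := hbody _ L.2
    exact (tendsto_integral_log_suppFn hνsupp hρ hb (fun i => (K i).2.2.2.1) hbL L.2.2.2.1
      (fun i => (K i).2.2.2.2) (fun i => (K i).2.1) hd).sub
      (((hFcont _ _ hb hbL hd).log (hFpos _ hbL).ne').const_mul _)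
  have hball : (⟨⟨Metric.closedBall 0 1, isCompact_closedBall _ _⟩,
      Metric.nonempty_closedBall.2 zero_le_one⟩ :
      NonemptyCompacts (EuclideanSpace ℝ (Fin n))) ∈ T :=
    ⟨subset_rfl, convex_closedBall _ _, (by simp [neg_closedBall] :
      Metric.closedBall (0 : EuclideanSpace ℝ (Fin n)) 1 = -Metric.closedBall 0 1),
      Metric.closedBall_subset_closedBall hρ1⟩
  obtain ⟨K, hKT, hK⟩ := hcomp.exists_isMinOn ⟨_, hball⟩ hcont
  refine ⟨K, hbody K hKT, hKT.2.2.1, fun L hL hLsymm hLρ hL1 => ?_⟩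
  exact hK (show (⟨⟨L, hL.1⟩, hL.nonempty⟩ : NonemptyCompacts (EuclideanSpace ℝ (Fin n))) ∈ T from
    ⟨hL1, hL.2.1, hLsymm, hLρ⟩)

lemma exists_min_logFunctional (hn : 0 < n) (hνsupp : ν (unitSphere n)ᶜ = 0)
    (hνscc : ∀ H : Submodule ℝ (EuclideanSpace ℝ (Fin n)),
      0 < Module.finrank ℝ H → Module.finrank ℝ H < n →
      ν ((H : Set (EuclideanSpace ℝ (Fin n))) ∩ unitSphere n)
        < ((Module.finrank ℝ H : ℝ≥0∞) / (n : ℝ≥0∞)) * ν (unitSphere n))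
    (hα : α ≠ 0) (hFpos : ∀ K, IsConvexBody K → 0 < F K)
    (hFcont : ∀ (K : ℕ → Set (EuclideanSpace ℝ (Fin n))) (L),
      (∀ i, IsConvexBody (K i)) → IsConvexBody L →
      Tendsto (fun i => Metric.hausdorffDist (K i) L) atTop (𝓝 0) →
      Tendsto (fun i => F (K i)) atTop (𝓝 (F L)))
    (hFhom : ∀ K, IsConvexBody K → ∀ t : ℝ, 0 < t → F (t • K) = t ^ α * F K)
    (hB : ∃ C : ℝ, 0 < C ∧ ∀ K, IsConvexBody K →
      (F K) ^ (1 / α) ≤ C * (volume K).toReal ^ (1 / (n : ℝ))) :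
    ∃ K, IsConvexBody K ∧ K = -K ∧ ∀ L, IsConvexBody L → L = -L →
      logFunctional ν α F K ≤ logFunctional ν α F L := by
  obtain ⟨A, η, c, hη, hc, hcoer⟩ := exists_coercive_bound hn hνsupp hνscc hFpos hB
  set M := logFunctional ν α F (Metric.closedBall 0 1)
  set T := max 0 ((M - A) / η)
  set ρ := min (c * Real.exp (-T)) 1
  have hρ : 0 < ρ := lt_min (mul_pos hc (Real.exp_pos _)) one_pos
  obtain ⟨K, hK, hKsymm, hmin⟩ :=
    exists_min_logFunctional_between (α := α) hνsupp hFpos hFcont hρ (min_le_right _ _)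
  refine ⟨K, hK, hKsymm, fun L hL hLsymm => ?_⟩
  obtain ⟨s, R, hs, hR, hLR, hsL, hbound⟩ := hcoer L hL hLsymm
  by_cases hT : T ≤ Real.log R - Real.log s
  · have hKM : logFunctional ν α F K ≤ M :=
      hmin _ (isConvexBody_of_closedBall_subset (isCompact_closedBall _ _)
        (convex_closedBall _ _) one_pos subset_rfl) (by simp [neg_closedBall])
        (Metric.closedBall_subset_closedBall (min_le_right _ _)) subset_rfl
    have h1 : (M - A) / η ≤ Real.log R - Real.log s := (le_max_right _ _).trans hT
    rw [div_le_iff₀ hη] at h1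
    linarith
  · push Not at hT
    have hRs : R * Real.exp (-T) ≤ s := by
      rw [← Real.log_le_log_iff (by positivity) hs, Real.log_mul hR.ne' (Real.exp_pos _).ne',
        Real.log_exp]
      linarith
    rw [← logFunctional_smul hνsupp hα hFpos hFhom hL hLsymm (inv_pos.2 hR)]
    refine hmin _ (isConvexBody_smul hL (inv_pos.2 hR)) (smul_eq_neg_smul hLsymm _) ?_ ?_
    · rw [Set.subset_smul_set_iff₀ (inv_ne_zero hR.ne'), inv_inv, smul_closedBall _ _ hρ.le,
        smul_zero, Real.norm_of_nonneg hR.le]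
      refine (Metric.closedBall_subset_closedBall ?_).trans hsL
      calc R * ρ ≤ R * (c * Real.exp (-T)) := mul_le_mul_of_nonneg_left (min_le_left _ _) hR.le
        _ = c * (R * Real.exp (-T)) := by ring
        _ ≤ c * s := mul_le_mul_of_nonneg_left hRs hc.le
    · rw [Set.smul_set_subset_iff₀ (inv_ne_zero hR.ne'), inv_inv, smul_closedBall _ _ zero_le_one,
        smul_zero, Real.norm_of_nonneg hR.le, mul_one]
      exact hLR

end LogFunctional

section Variation

variable {n : ℕ} {ν : Measure (EuclideanSpace ℝ (Fin n))} [IsFiniteMeasure ν]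
  {K : Set (EuclideanSpace ℝ (Fin n))} {α : ℝ} {F : Set (EuclideanSpace ℝ (Fin n)) → ℝ}
  {σ : Set (EuclideanSpace ℝ (Fin n)) → Measure (EuclideanSpace ℝ (Fin n))}

lemma integral_eq_of_isMin_logFunctional (hn : 0 < n) (hνsupp : ν (unitSphere n)ᶜ = 0)
    (hνpos : 0 < ν.real Set.univ)
    (hα : α ≠ 0) (hFpos : ∀ K, IsConvexBody K → 0 < F K)
    (hC : ∀ K, IsConvexBody K → 0 ∈ interior K →
      ∀ f : EuclideanSpace ℝ (Fin n) → ℝ, Continuous f →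
      Tendsto (fun t : ℝ =>
          (F (wulff (fun u => suppFn K u * Real.exp (t * f u))) - F K) / t)
        (𝓝[≠] (0 : ℝ))
        (𝓝 (Real.sign α * ∫ u, suppFn K u * f u ∂(σ K))))
    (hK : IsConvexBody K) (hsymm : K = -K) (hFK : F K = ν.real Set.univ)
    (hmin : ∀ L, IsConvexBody L → L = -L → logFunctional ν α F K ≤ logFunctional ν α F L)
    {f : EuclideanSpace ℝ (Fin n) → ℝ} (hf : Continuous f) (hfeven : ∀ u, f (-u) = f u) :
    ∫ u, f u ∂ν = 1 / |α| * ∫ u, suppFn K u * f u ∂(σ K) := by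
  have hae : ∀ᵐ u ∂ν, u ∈ unitSphere n := by rwa [ae_iff]
  set W : ℝ → Set (EuclideanSpace ℝ (Fin n)) :=
    fun t => wulff fun u => suppFn K u * Real.exp (t * f u)
  have hW : ∀ t, IsConvexBody (W t) := fun t =>
    isConvexBody_wulff hn ((continuous_suppFn hK.1 hK.nonempty).mul
      (Real.continuous_exp.comp (continuous_const.mul hf)))
      fun u hu => mul_pos (suppFn_pos hK hsymm hu) (Real.exp_pos _)
  have hWsymm : ∀ t, W t = -W t := fun t =>
    wulff_eq_neg fun u => by rw [suppFn_neg_right hsymm, hfeven]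
  set G : ℝ → ℝ := fun t => if t = 0 then F K else F (W t) with hG
  have hG0 : G 0 = F K := if_pos rfl
  have hGderiv : HasDerivAt G (Real.sign α * ∫ u, suppFn K u * f u ∂(σ K)) 0 := by
    rw [hasDerivAt_iff_tendsto_slope]
    refine (hC K hK (zero_mem_interior_of_symmetric hK hsymm) f hf).congr' ?_
    filter_upwards [self_mem_nhdsWithin] with t ht
    rw [slope_def_field, hG0, sub_zero, hG]
    simp only [if_neg (show t ≠ 0 from ht), W]
  have hfint : Integrable f ν := integrable_of_continuousOn_unitSphere hνsupp hf.continuousOn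
  set P : ℝ → ℝ := fun t => ∫ u, Real.log (suppFn K u) ∂ν + t * ∫ u, f u ∂ν -
    ν.real Set.univ / α * Real.log (G t) with hP
  have hPmin : IsLocalMin P 0 := by
    refine Eventually.of_forall fun t => ?_
    rcases eq_or_ne t 0 with rfl | ht
    · exact le_rfl
    have h1 := hmin (W t) (hW t) (hWsymm t)
    have h2 : ∫ u, Real.log (suppFn (W t) u) ∂ν ≤
        ∫ u, (Real.log (suppFn K u) + t * f u) ∂ν := by
      refine integral_mono_ae (integrable_log_suppFn hνsupp (hW t) (hWsymm t))
        ((integrable_log_suppFn hνsupp hK hsymm).add (hfint.const_mul t)) ?_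
      filter_upwards [hae] with u hu
      refine (Real.log_le_log (suppFn_pos (hW t) (hWsymm t) hu)
        (suppFn_wulff_le (hW t).nonempty hu)).trans_eq ?_
      rw [Real.log_mul (suppFn_pos hK hsymm hu).ne' (Real.exp_pos _).ne', Real.log_exp]
    rw [integral_add (integrable_log_suppFn hνsupp hK hsymm) (hfint.const_mul t),
      integral_const_mul] at h2
    simp only [hP, hG, if_pos, if_neg ht, zero_mul, add_zero]
    rw [logFunctional, logFunctional] at h1
    linarith
  have hPderiv := (((hasDerivAt_id (0 : ℝ)).mul_const (∫ u, f u ∂ν)).const_add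
    (∫ u, Real.log (suppFn K u) ∂ν)).sub
      ((hGderiv.log (by rw [hG0]; exact (hFpos K hK).ne')).const_mul (ν.real Set.univ / α))
  have hzero := hPmin.hasDerivAt_eq_zero hPderiv
  have hsign : Real.sign α / α = 1 / |α| := by
    rcases hα.lt_or_gt with h | h
    · rw [Real.sign_of_neg h, abs_of_neg h]
      field_simp
    · rw [Real.sign_of_pos h, abs_of_pos h]
  rw [hG0, hFK, sub_eq_zero, one_mul] at hzero
  rw [hzero, ← hsign]
  field_simp

lemma integral_eq_integral_even_part {μ : Measure (EuclideanSpace ℝ (Fin n))}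
    (hμ : μ.map (fun x => -x) = μ) {f : EuclideanSpace ℝ (Fin n) → ℝ} (hf : Integrable f μ) :
    ∫ u, f u ∂μ = ∫ u, (f u + f (-u)) / 2 ∂μ := by
  have hneg : MeasurePreserving (fun x : EuclideanSpace ℝ (Fin n) => -x) μ μ :=
    ⟨measurable_neg, hμ⟩
  have h1 : ∫ u, f (-u) ∂μ = ∫ u, f u ∂μ :=
    hneg.integral_comp (Homeomorph.neg _).measurableEmbedding f
  have h2 : Integrable (fun u => f (-u)) μ := hneg.integrable_comp_of_integrable hf
  rw [integral_div, integral_add hf h2, h1]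
  ring

lemma eq_withDensity_of_integral_eq {μ : Measure (EuclideanSpace ℝ (Fin n))} [IsFiniteMeasure μ]
    (hνsupp : ν (unitSphere n)ᶜ = 0) (hνeven : ν.map (fun x => -x) = ν)
    (hμsupp : μ (unitSphere n)ᶜ = 0) (hμeven : μ.map (fun x => -x) = μ)
    (hK : IsConvexBody K) (hsymm : K = -K)
    (h : ∀ f : EuclideanSpace ℝ (Fin n) → ℝ, Continuous f → (∀ u, f (-u) = f u) →
      ∫ u, f u ∂ν = 1 / |α| * ∫ u, suppFn K u * f u ∂μ) :
    ν = μ.withDensity fun u => ENNReal.ofReal (1 / |α| * suppFn K u) := by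
  have hae : ∀ᵐ u ∂μ, u ∈ unitSphere n := by rwa [ae_iff]
  have hcont : Continuous fun u => 1 / |α| * suppFn K u :=
    continuous_const.mul (continuous_suppFn hK.1 hK.nonempty)
  have hInt : ∀ f : EuclideanSpace ℝ (Fin n) → ℝ, Continuous f → Integrable f μ := fun f hf =>
    integrable_of_continuousOn_unitSphere hμsupp hf.continuousOn
  have : IsFiniteMeasure (μ.withDensity fun u => ENNReal.ofReal (1 / |α| * suppFn K u)) :=
    isFiniteMeasure_withDensity_ofReal (hInt _ hcont).2
  refine ext_of_forall_integral_eq_of_IsFiniteMeasure fun f => ?_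
  have hf : Continuous fun u => f u := f.continuous
  rw [integral_withDensity_eq_integral_toReal_smul hcont.measurable.ennreal_ofReal
      (Eventually.of_forall fun _ => ENNReal.ofReal_lt_top),
    integral_eq_integral_even_part hνeven
      (integrable_of_continuousOn_unitSphere hνsupp hf.continuousOn),
    h (fun u => (f u + f (-u)) / 2) ((hf.add (hf.comp continuous_neg)).div_const 2)
      fun u => by rw [neg_neg, add_comm]]
  have hμ : ∫ u, (ENNReal.ofReal (1 / |α| * suppFn K u)).toReal • f u ∂μ =
      ∫ u, 1 / |α| * (suppFn K u * f u) ∂μ := by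
    refine integral_congr_ae ?_
    filter_upwards [hae] with u hu
    rw [ENNReal.toReal_ofReal (mul_nonneg (by positivity) (suppFn_pos hK hsymm hu).le),
      smul_eq_mul, mul_assoc]
  rw [hμ, integral_const_mul, integral_eq_integral_even_part
      (f := fun u => suppFn K u * f u) hμeven
    (hInt _ ((continuous_suppFn hK.1 hK.nonempty).mul hf))]
  congr 1
  refine integral_congr_ae (Eventually.of_forall fun u => ?_)
  simp only [suppFn_neg_right hsymm]
  ring

end Variation

/-- solution of the even logarithmic Minkowski problem for a positive,
continuous, `α`-homogeneous functional `F` with properties (A), (B), (C). -/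
theorem even_log_minkowski_problem (n : ℕ) (hn : 2 ≤ n)
    (ν : Measure (EuclideanSpace ℝ (Fin n))) [IsFiniteMeasure ν]
    (hνsupp : ν (unitSphere n)ᶜ = 0)
    (hνeven : ν.map (fun x => -x) = ν)
    (hνpos : 0 < ν (unitSphere n))
    (hνscc : ∀ H : Submodule ℝ (EuclideanSpace ℝ (Fin n)),
      0 < Module.finrank ℝ H → Module.finrank ℝ H < n →
      ν ((H : Set (EuclideanSpace ℝ (Fin n))) ∩ unitSphere n)
        < ((Module.finrank ℝ H : ℝ≥0∞) / (n : ℝ≥0∞)) * ν (unitSphere n))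
    (α : ℝ) (hα : α ≠ 0)
    (F : Set (EuclideanSpace ℝ (Fin n)) → ℝ)
    (hFpos : ∀ K, IsConvexBody K → 0 < F K)
    (hFcont : ∀ (K : ℕ → Set (EuclideanSpace ℝ (Fin n))) (L),
      (∀ i, IsConvexBody (K i)) → IsConvexBody L →
      Tendsto (fun i => Metric.hausdorffDist (K i) L) atTop (𝓝 0) →
      Tendsto (fun i => F (K i)) atTop (𝓝 (F L)))
    (hFhom : ∀ K, IsConvexBody K → ∀ t : ℝ, 0 < t → F (t • K) = t ^ α * F K)
    -- property (A): monotonicity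
    (hA : ∀ K L, IsConvexBody K → IsConvexBody L → K ⊆ L →
      Real.sign α * F K ≤ Real.sign α * F L)
    -- property (B): isoperimetric-type control by the volume
    (hB : ∃ C : ℝ, 0 < C ∧ ∀ K, IsConvexBody K →
      (F K) ^ (1 / α) ≤ C * (volume K).toReal ^ (1 / (n : ℝ)))
    -- property (C): Hadamard derivative, with associated measures `σ K`
    (σ : Set (EuclideanSpace ℝ (Fin n)) → Measure (EuclideanSpace ℝ (Fin n)))
    (hσfin : ∀ K, IsFiniteMeasure (σ K))
    (hσsupp : ∀ K, (σ K) (unitSphere n)ᶜ = 0)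
    (hσeven : ∀ K, IsConvexBody K → K = -K → (σ K).map (fun x => -x) = σ K)
    (hC : ∀ K, IsConvexBody K → 0 ∈ interior K →
      ∀ f : EuclideanSpace ℝ (Fin n) → ℝ, Continuous f →
      Tendsto (fun t : ℝ =>
          (F (wulff (fun u => suppFn K u * Real.exp (t * f u))) - F K) / t)
        (𝓝[≠] (0 : ℝ))
        (𝓝 (Real.sign α * ∫ u, suppFn K u * f u ∂(σ K)))) :
    ∃ K, IsConvexBody K ∧ K = -K ∧
      ν = (σ K).withDensity (fun u => ENNReal.ofReal ((1 / |α|) * suppFn K u)) ∧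
      ν (unitSphere n) = ENNReal.ofReal (F K) := by
  have hn0 : 0 < n := by omega
  have hνuniv : ν (unitSphere n) = ν Set.univ :=
    measure_eq_measure_of_null_sdiff (Set.subset_univ _) (by rwa [← Set.compl_eq_univ_sdiff])
  have hm : 0 < ν.real Set.univ :=
    ENNReal.toReal_pos (hνuniv ▸ hνpos.ne') (measure_ne_top _ _)
  obtain ⟨K₀, hK₀, hsymm₀, hmin₀⟩ :=
    exists_min_logFunctional hn0 hνsupp hνscc hα hFpos hFcont hFhom hB
  have hquot : 0 < ν.real Set.univ / F K₀ := div_pos hm (hFpos K₀ hK₀)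
  set t := (ν.real Set.univ / F K₀) ^ (1 / α)
  have ht : 0 < t := Real.rpow_pos_of_pos hquot _
  have hFK : F (t • K₀) = ν.real Set.univ := by
    rw [hFhom K₀ hK₀ t ht, ← Real.rpow_mul hquot.le, one_div_mul_cancel hα, Real.rpow_one,
      div_mul_cancel₀ _ (hFpos K₀ hK₀).ne']
  have hK := isConvexBody_smul hK₀ ht
  have hsymm := smul_eq_neg_smul hsymm₀ t
  refine ⟨t • K₀, hK, hsymm, ?_, ?_⟩
  · have := hσfin (t • K₀)
    refine eq_withDensity_of_integral_eq hνsupp hνeven (hσsupp _) (hσeven _ hK hsymm) hK hsymm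
      fun f hf hfeven => integral_eq_of_isMin_logFunctional hn0 hνsupp hm hα hFpos hC hK hsymm hFK
        (fun L hL hLsymm => ?_) hf hfeven
    rw [logFunctional_smul hνsupp hα hFpos hFhom hK₀ hsymm₀ ht]
    exact hmin₀ L hL hLsymm
  · rw [hFK, hνuniv, ofReal_measureReal]
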